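/- Let 1 ≤ s ≤ m-1 and k ≥ 0, and let Ker_k^s∂^- denote the space of k-homogeneous Cl^s-valued polynomials P with ∂^-P = 0. Then P_k^s = Ker_k^s∂^- ⊕ (x∧)Ker_{k-1}^{s-1}∂^-, and the projection onto Ker_k^s∂^- along the second summand is P^- = -(m-s+k)^{-1} ∂^-(x∧). -/

import Mathlib

noncomputable section
open scoped TensorProduct
open CliffordAlgebra MvPolynomial

/-- The quadratic form of signature (0,m): Q(x) = -|x|². -/
def Qf (m : ℕ) : QuadraticForm ℝ (Fin m → ℝ) :=
  - QuadraticMap.weightedSumSquares ℝ (fun _ : Fin m => (1 : ℝ))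

/-- The real Clifford algebra Cl(0,m). -/
abbrev Cl (m : ℕ) := CliffordAlgebra (Qf m)

/-- The generators e₁,…,e_m. -/
def e (m : ℕ) (i : Fin m) : Cl m := CliffordAlgebra.ι (Qf m) (Pi.single i 1)

/-- Left outer (wedge) multiplication by `c`:  v ↦ (1/2)(c v + α(v) c). -/
def wedgeL (m : ℕ) (c : Cl m) : Cl m →ₗ[ℝ] Cl m :=
  (1/2 : ℝ) • (LinearMap.mulLeft ℝ c +
    (LinearMap.mulRight ℝ c) ∘ₗ (involute (Q := Qf m)).toLinearMap)

/-- Left inner (dot) multiplication by `c`:  v ↦ (1/2)(c v - α(v) c). -/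
def dotL (m : ℕ) (c : Cl m) : Cl m →ₗ[ℝ] Cl m :=
  (1/2 : ℝ) • (LinearMap.mulLeft ℝ c -
    (LinearMap.mulRight ℝ c) ∘ₗ (involute (Q := Qf m)).toLinearMap)

/-- Scalar polynomials on ℝ^m. -/
abbrev Pm (m : ℕ) := MvPolynomial (Fin m) ℝ

/-- The space P* of Cl(0,m)-valued polynomials on ℝ^m. -/
abbrev MS (m : ℕ) := Pm m ⊗[ℝ] Cl m

/-- Build an operator on Cl-valued polynomials from operators on each factor. -/
def op (m : ℕ) (f : Pm m →ₗ[ℝ] Pm m) (g : Cl m →ₗ[ℝ] Cl m) : Module.End ℝ (MS m) :=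
  TensorProduct.map f g

/-- The operator (x∧) of outer multiplication by the vector variable. -/
def xWedge (m : ℕ) : Module.End ℝ (MS m) :=
  ∑ j : Fin m, op m (LinearMap.mulLeft ℝ (X j)) (wedgeL m (e m j))

/-- The operator (x•) of inner multiplication by the vector variable. -/
def xDot (m : ℕ) : Module.End ℝ (MS m) :=
  ∑ j : Fin m, op m (LinearMap.mulLeft ℝ (X j)) (dotL m (e m j))

/-- Left Clifford multiplication by the vector variable x. -/
def Xmul (m : ℕ) : Module.End ℝ (MS m) :=
  ∑ j : Fin m, op m (LinearMap.mulLeft ℝ (X j)) (LinearMap.mulLeft ℝ (e m j))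

/-- The Dirac operator ∂ = Σ e_j ∂_{x_j}. -/
def Dirac (m : ℕ) : Module.End ℝ (MS m) :=
  ∑ j : Fin m, op m (pderiv j).toLinearMap (LinearMap.mulLeft ℝ (e m j))

/-- The exterior part ∂⁺ of the Dirac operator. -/
def dplus (m : ℕ) : Module.End ℝ (MS m) :=
  ∑ j : Fin m, op m (pderiv j).toLinearMap (wedgeL m (e m j))

/-- The interior part ∂⁻ of the Dirac operator. -/
def dminus (m : ℕ) : Module.End ℝ (MS m) :=
  ∑ j : Fin m, op m (pderiv j).toLinearMap (dotL m (e m j))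

/-- The Euler operator E = Σ x_j ∂_{x_j}. -/
def Euler (m : ℕ) : Module.End ℝ (MS m) :=
  ∑ j : Fin m, op m (LinearMap.mulLeft ℝ (X j) ∘ₗ (pderiv j).toLinearMap) LinearMap.id

/-- The fermionic Euler operator ∂⁺⌋ = -Σ (e_j∧)(e_j•). -/
def fermPlus (m : ℕ) : Module.End ℝ (MS m) :=
  - ∑ j : Fin m, op m LinearMap.id (wedgeL m (e m j) ∘ₗ dotL m (e m j))

/-- The fermionic Euler operator ∂⁻⌋ = -Σ (e_j•)(e_j∧). -/
def fermMinus (m : ℕ) : Module.End ℝ (MS m) :=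
  - ∑ j : Fin m, op m LinearMap.id (dotL m (e m j) ∘ₗ wedgeL m (e m j))

/-- The Laplacian Δ = Σ ∂_{x_j}². -/
def Lap (m : ℕ) : Module.End ℝ (MS m) :=
  ∑ j : Fin m, op m ((pderiv j).toLinearMap ∘ₗ (pderiv j).toLinearMap) LinearMap.id

/-- Multiplication by the Clifford square x² = -(x₁²+⋯+x_m²) of the vector variable. -/
def Mx2 (m : ℕ) : Module.End ℝ (MS m) :=
  op m (LinearMap.mulLeft ℝ (-(∑ j : Fin m, (X j : Pm m) ^ 2))) LinearMap.id

/-- The space Cl^s of s-vectors: the span of products of s distinct generators. -/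
def clGrade (m s : ℕ) : Submodule ℝ (Cl m) :=
  Submodule.span ℝ
    {x | ∃ l : List (Fin m), l.length = s ∧ l.Nodup ∧ x = (l.map (e m)).prod}

/-- The space P_k^s of k-homogeneous s-vector valued polynomials. -/
def Pks (m k s : ℕ) : Submodule ℝ (MS m) :=
  LinearMap.range (TensorProduct.map
    (MvPolynomial.homogeneousSubmodule (Fin m) ℝ k).subtype (clGrade m s).subtype)

/-- The space of s-vector valued polynomials (no homogeneity). -/
def PsVal (m s : ℕ) : Submodule ℝ (MS m) :=
  LinearMap.range (TensorProduct.map (LinearMap.id : Pm m →ₗ[ℝ] Pm m) (clGrade m s).subtype)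

/-- Homogeneous solutions of the Hodge–de Rham system: ∂⁺P = 0 and ∂⁻P = 0. -/
def Hks (m k s : ℕ) : Submodule ℝ (MS m) :=
  Pks m k s ⊓ LinearMap.ker (dplus m) ⊓ LinearMap.ker (dminus m)

/-- Homogeneous s-vector valued monogenic polynomials: ∂P = 0. -/
def HksD (m k s : ℕ) : Submodule ℝ (MS m) :=
  Pks m k s ⊓ LinearMap.ker (Dirac m)

/-- Ker_k^s ∂⁺. -/
def KerP (m k s : ℕ) : Submodule ℝ (MS m) :=
  Pks m k s ⊓ LinearMap.ker (dplus m)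

/-- Ker_k^s ∂⁻. -/
def KerM (m k s : ℕ) : Submodule ℝ (MS m) :=
  Pks m k s ⊓ LinearMap.ker (dminus m)

end

section Helpers
open scoped TensorProduct
open CliffordAlgebra MvPolynomial

lemma hp_sq (m : ℕ) (i : Fin m) : e m i * e m i = -1 := by
  unfold e
  rw [CliffordAlgebra.ι_sq_scalar]
  have : Qf m (Pi.single i 1) = -1 := by
    simp [Qf, QuadraticMap.weightedSumSquares_apply, Pi.single_apply]
  rw [this, map_neg, map_one]

lemma hp_anti (m : ℕ) {i j : Fin m} (h : i ≠ j) : e m i * e m j = - (e m j * e m i) := by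
  unfold e
  apply ι_mul_ι_comm_of_isOrtho
  rw [QuadraticMap.isOrtho_def]
  simp only [Qf, neg_apply, QuadraticMap.weightedSumSquares_apply, Pi.add_apply,
    one_smul]
  rw [← neg_add, ← Finset.sum_add_distrib]
  congr 1
  refine Finset.sum_congr rfl fun a _ => ?_
  have : (Pi.single i 1 : Fin m → ℝ) a * (Pi.single j 1 : Fin m → ℝ) a = 0 := by
    by_cases h1 : a = i
    · subst h1; simp [Pi.single_apply, h]
    · simp [Pi.single_apply, h1]
  linear_combination 2 * this

lemma hp_inv (m : ℕ) (i : Fin m) : involute (e m i) = - e m i := by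
  unfold e; simp

lemma hp_wedge (m : ℕ) (c v : Cl m) :
    wedgeL m c v = (1/2 : ℝ) • (c * v + involute v * c) := by simp [wedgeL]

lemma hp_dot (m : ℕ) (c v : Cl m) :
    dotL m c v = (1/2 : ℝ) • (c * v - involute v * c) := by simp [dotL]

lemma hp_dd (m : ℕ) (i j : Fin m) (v : Cl m) :
    dotL m (e m i) (dotL m (e m j) v) = - dotL m (e m j) (dotL m (e m i) v) := by
  have key : e m i * e m j + e m j * e m i = -(if i = j then (2:ℝ) else 0) • (1 : Cl m) := by
    split_ifs with h
    · subst h; rw [hp_sq]; module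
    · rw [hp_anti m h]; simp
  have k1 : (e m i * e m j) * v + (e m j * e m i) * v = -(if i = j then (2:ℝ) else 0) • v := by
    rw [← add_mul, key, smul_mul_assoc, one_mul]
  have k2 : v * (e m i * e m j) + v * (e m j * e m i) = -(if i = j then (2:ℝ) else 0) • v := by
    rw [← mul_add, key, mul_smul_comm, mul_one]
  have k3 := k1.trans k2.symm
  simp only [hp_dot, map_smul, map_sub, map_mul, hp_inv, involute_involute, mul_sub, sub_mul,
    mul_smul_comm, smul_mul_assoc, neg_mul, mul_neg, mul_assoc] at k3 ⊢
  linear_combination (norm := module) (1/4 : ℝ) • k3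

lemma hp_dw (m : ℕ) (i j : Fin m) (v : Cl m) :
    dotL m (e m i) (wedgeL m (e m j) v) =
      - wedgeL m (e m j) (dotL m (e m i) v) - (if i = j then v else 0) := by
  have key : e m i * e m j + e m j * e m i = -(if i = j then (2:ℝ) else 0) • (1 : Cl m) := by
    split_ifs with h
    · subst h; rw [hp_sq]; module
    · rw [hp_anti m h]; simp
  have k1 : (e m i * e m j) * v + (e m j * e m i) * v = -(if i = j then (2:ℝ) else 0) • v := by
    rw [← add_mul, key, smul_mul_assoc, one_mul]
  have k2 : v * (e m i * e m j) + v * (e m j * e m i) = -(if i = j then (2:ℝ) else 0) • v := by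
    rw [← mul_add, key, mul_smul_comm, mul_one]
  have hv : (if i = j then v else 0) = (1/2 : ℝ) • ((if i = j then (2:ℝ) else 0) • v) := by
    split_ifs <;> simp
  rw [hv]
  generalize (if i = j then (2:ℝ) else 0) = c at *
  simp only [hp_dot, hp_wedge, map_smul, map_sub, map_add, map_mul, hp_inv, involute_involute,
    mul_sub, sub_mul, mul_add, add_mul,
    mul_smul_comm, smul_mul_assoc, neg_mul, mul_neg, mul_assoc] at k1 k2 ⊢
  linear_combination (norm := module) (1/4 : ℝ) • k1 + (1/4 : ℝ) • k2

lemma hp_notMem (m : ℕ) (j : Fin m) (l : List (Fin m)) (h : j ∉ l) :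
    e m j * (l.map (e m)).prod = involute (l.map (e m)).prod * e m j := by
  induction l with
  | nil => simp
  | cons a l ih =>
    simp only [List.mem_cons, not_or] at h
    simp only [List.map_cons, List.prod_cons, map_mul, hp_inv]
    rw [← mul_assoc, hp_anti m h.1, neg_mul, mul_assoc, ih h.2]
    simp [mul_assoc]

lemma hp_invprod (m : ℕ) (l : List (Fin m)) :
    involute (l.map (e m)).prod = (-1 : ℝ) ^ l.length • (l.map (e m)).prod := by
  induction l with
  | nil => simp
  | cons a l ih =>
    simp [hp_inv, ih, pow_succ]

lemma hp_mem (m : ℕ) (j : Fin m) (a b : List (Fin m)) (ha : j ∉ a) (hb : j ∉ b) :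
    e m j * ((a ++ j :: b).map (e m)).prod =
      - (involute (a.map (e m)).prod * (b.map (e m)).prod) ∧
    involute ((a ++ j :: b).map (e m)).prod * e m j =
      (involute (a.map (e m)).prod * (b.map (e m)).prod) := by
  simp only [List.map_append, List.prod_append, List.map_cons, List.prod_cons, map_mul, hp_inv]
  constructor
  · rw [← mul_assoc, hp_notMem m j a ha, mul_assoc, ← mul_assoc (e m j), hp_sq]
    simp
  · rw [mul_assoc, mul_assoc, ← hp_notMem m j b hb, ← mul_assoc (-e m j), neg_mul, hp_sq]
    simp

lemma hp_split (m : ℕ) (j : Fin m) (l : List (Fin m)) (hl : l.Nodup) (h : j ∈ l) :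
    ∃ a b, l = a ++ j :: b ∧ j ∉ a ∧ j ∉ b ∧ (a ++ b).Nodup := by
  obtain ⟨a, b, rfl⟩ := List.append_of_mem h
  have h2 := List.nodup_middle.1 hl
  rw [List.nodup_cons, List.mem_append, not_or] at h2
  exact ⟨a, b, rfl, h2.1.1, h2.1.2, h2.2⟩

lemma hp_wedge_mem (m : ℕ) (j : Fin m) (l : List (Fin m)) (hl : l.Nodup) (h : j ∈ l) :
    wedgeL m (e m j) (l.map (e m)).prod = 0 := by
  obtain ⟨a, b, rfl, ha, hb, -⟩ := hp_split m j l hl h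
  rw [hp_wedge, (hp_mem m j a b ha hb).1, (hp_mem m j a b ha hb).2]; simp

lemma hp_dot_notMem (m : ℕ) (j : Fin m) (l : List (Fin m)) (h : j ∉ l) :
    dotL m (e m j) (l.map (e m)).prod = 0 := by
  rw [hp_dot, hp_notMem m j l h]; simp

lemma hp_grade_wedge (m s : ℕ) (j : Fin m) (v : Cl m) (hv : v ∈ clGrade m s) :
    wedgeL m (e m j) v ∈ clGrade m (s + 1) := by
  induction hv using Submodule.span_induction with
  | mem x hx =>
    obtain ⟨l, hl, hn, rfl⟩ := hx
    by_cases h : j ∈ l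
    · rw [hp_wedge_mem m j l hn h]; exact zero_mem _
    · rw [hp_wedge, ← hp_notMem m j l h]
      apply Submodule.smul_mem
      have : e m j * (l.map (e m)).prod ∈ clGrade m (s + 1) :=
        Submodule.subset_span ⟨j :: l, by simp [hl], by simp [h, hn], by simp⟩
      exact add_mem this this
  | zero => simp
  | add x y _ _ hx hy => rw [map_add]; exact add_mem hx hy
  | smul a x _ hx => rw [map_smul]; exact Submodule.smul_mem _ _ hx

lemma hp_grade_dot (m s : ℕ) (j : Fin m) (v : Cl m) (hv : v ∈ clGrade m (s + 1)) :
    dotL m (e m j) v ∈ clGrade m s := by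
  induction hv using Submodule.span_induction with
  | mem x hx =>
    obtain ⟨l, hl, hn, rfl⟩ := hx
    by_cases h : j ∈ l
    · obtain ⟨a, b, rfl, ha, hb, hab⟩ := hp_split m j l hn h
      rw [hp_dot, (hp_mem m j a b ha hb).1, (hp_mem m j a b ha hb).2, hp_invprod]
      have : (a.map (e m)).prod * (b.map (e m)).prod ∈ clGrade m s :=
        Submodule.subset_span ⟨a ++ b, by simp at hl ⊢; omega, hab, by simp⟩
      rw [smul_mul_assoc]
      exact Submodule.smul_mem _ _ (sub_mem (neg_mem (Submodule.smul_mem _ _ this))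
        (Submodule.smul_mem _ _ this))
    · rw [hp_dot_notMem m j l h]; exact zero_mem _
  | zero => simp
  | add x y _ _ hx hy => rw [map_add]; exact add_mem hx hy
  | smul a x _ hx => rw [map_smul]; exact Submodule.smul_mem _ _ hx

lemma hp_sum_wd (m s : ℕ) (v : Cl m) (hv : v ∈ clGrade m s) :
    ∑ j, wedgeL m (e m j) (dotL m (e m j) v) = -(s : ℝ) • v := by
  induction hv using Submodule.span_induction with
  | mem x hx =>
    obtain ⟨l, hl, hn, rfl⟩ := hx
    have : ∀ j, wedgeL m (e m j) (dotL m (e m j) (l.map (e m)).prod) =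
        if j ∈ l.toFinset then -(l.map (e m)).prod else 0 := by
      intro j
      split_ifs with h <;> rw [List.mem_toFinset] at h
      · have := hp_dw m j j (l.map (e m)).prod
        rw [hp_wedge_mem m j l hn h, if_pos rfl, map_zero] at this
        linear_combination (norm := module) this
      · rw [hp_dot_notMem m j l h, map_zero]
    rw [Finset.sum_congr rfl fun j _ => this j, Finset.sum_ite_mem, Finset.univ_inter,
      Finset.sum_const, List.toFinset_card_of_nodup hn, hl]
    simp [Nat.cast_smul_eq_nsmul]
  | zero => simp
  | add x y _ _ hx hy => simp only [map_add, Finset.sum_add_distrib, hx, hy, smul_add]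
  | smul a x _ hx =>
    simp only [map_smul, ← Finset.smul_sum, hx]
    rw [smul_comm]

lemma hp_pderiv_comm (m : ℕ) (i j : Fin m) (p : Pm m) :
    pderiv i (pderiv j p) = pderiv j (pderiv i p) := by
  have : ⁅(pderiv i : Derivation ℝ (Pm m) (Pm m)), (pderiv j : Derivation ℝ (Pm m) (Pm m))⁆ = 0 := by
    apply MvPolynomial.derivation_ext
    intro a
    simp [Derivation.commutator_apply, Pi.single_apply, apply_ite]
  have h2 := congrArg (fun D : Derivation ℝ (Pm m) (Pm m) => D p) this
  simpa [Derivation.commutator_apply, sub_eq_zero] using h2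

lemma hp_xWedge (m : ℕ) (p : Pm m) (v : Cl m) :
    xWedge m (p ⊗ₜ v) = ∑ j, (X j * p) ⊗ₜ wedgeL m (e m j) v := by
  simp [xWedge, op]

lemma hp_dminus (m : ℕ) (p : Pm m) (v : Cl m) :
    dminus m (p ⊗ₜ v) = ∑ j, (pderiv j p) ⊗ₜ dotL m (e m j) v := by
  simp [dminus, op]

lemma hp_dminus_sq (m : ℕ) (P : MS m) : dminus m (dminus m P) = 0 := by
  induction P using TensorProduct.induction_on with
  | zero => simp
  | add x y hx hy => simp [hx, hy]
  | tmul p v =>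
    simp only [hp_dminus, map_sum]
    have h : ∀ S : MS m, S = -S → S = 0 := by
      intro S h
      have h3 : (2 : ℝ) • S = 0 := by
        rw [two_smul]; nth_rewrite 1 [h]; exact neg_add_cancel S
      exact (smul_eq_zero.1 h3).resolve_left two_ne_zero
    apply h
    conv_rhs => rw [Finset.sum_comm]
    simp only [← Finset.sum_neg_distrib]
    refine Finset.sum_congr rfl fun i _ => Finset.sum_congr rfl fun j _ => ?_
    rw [hp_pderiv_comm, hp_dd, TensorProduct.tmul_neg]

lemma hp_ind (m k s : ℕ) (N : Submodule ℝ (MS m))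
    (h : ∀ p : Pm m, p.IsHomogeneous k → ∀ v ∈ clGrade m s, p ⊗ₜ v ∈ N) : Pks m k s ≤ N := by
  rintro _ ⟨y, rfl⟩
  induction y using TensorProduct.induction_on with
  | zero => simp
  | add x y hx hy => rw [map_add]; exact add_mem hx hy
  | tmul p v => exact h p.1 p.2 v.1 v.2

lemma hp_tmul_mem (m k s : ℕ) (p : Pm m) (hp : p.IsHomogeneous k) (v : Cl m)
    (hv : v ∈ clGrade m s) : p ⊗ₜ v ∈ Pks m k s :=
  ⟨(⟨p, hp⟩ : homogeneousSubmodule (Fin m) ℝ k) ⊗ₜ (⟨v, hv⟩ : clGrade m s), by simp⟩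

lemma hp_xW_mem (m k s : ℕ) (P : MS m) (hP : P ∈ Pks m k s) :
    xWedge m P ∈ Pks m (k + 1) (s + 1) := by
  refine hp_ind m k s ((Pks m (k + 1) (s + 1)).comap (xWedge m)) ?_ hP
  intro p hp v hv
  rw [Submodule.mem_comap, hp_xWedge]
  refine sum_mem fun j _ => hp_tmul_mem _ _ _ _ ?_ _ (hp_grade_wedge m s j v hv)
  rw [add_comm]
  exact (isHomogeneous_X ℝ j).mul hp

lemma hp_dm_mem (m k s : ℕ) (P : MS m) (hP : P ∈ Pks m k (s + 1)) :
    dminus m P ∈ Pks m (k - 1) s := by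
  refine hp_ind m k (s + 1) ((Pks m (k - 1) s).comap (dminus m)) ?_ hP
  intro p hp v hv
  rw [Submodule.mem_comap, hp_dminus]
  exact sum_mem fun j _ => hp_tmul_mem _ _ _ _ hp.pderiv _ (hp_grade_dot m s j v hv)

lemma hp_dm_zero (m s : ℕ) (P : MS m) (hP : P ∈ Pks m 0 s) : dminus m P = 0 := by
  refine hp_ind m 0 s (LinearMap.ker (dminus m)) ?_ hP
  intro p hp v hv
  rw [LinearMap.mem_ker, hp_dminus]
  refine Finset.sum_eq_zero fun j _ => ?_
  rw [totalDegree_eq_zero_iff_eq_C.1 (Nat.le_zero.1 hp.totalDegree_le)]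
  simp

lemma hp_key (m k s : ℕ) (P : MS m) (hP : P ∈ Pks m k s) :
    dminus m (xWedge m P) = - xWedge m (dminus m P) - ((m : ℝ) - s + k) • P := by
  have : P ∈ LinearMap.ker (dminus m ∘ₗ xWedge m + xWedge m ∘ₗ dminus m +
      ((m : ℝ) - s + k) • LinearMap.id) := by
    refine hp_ind m k s _ ?_ hP
    intro p hp v hv
    rw [LinearMap.mem_ker]
    simp only [LinearMap.add_apply, LinearMap.comp_apply, LinearMap.smul_apply, LinearMap.id_apply,
      hp_dminus, hp_xWedge, map_sum]
    have e1 : ∀ i j : Fin m, (pderiv i (X j * p)) ⊗ₜ[ℝ] dotL m (e m i) (wedgeL m (e m j) v) =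
        - ((X j * pderiv i p) ⊗ₜ[ℝ] wedgeL m (e m j) (dotL m (e m i) v))
        - (if i = j then (X j * pderiv j p) ⊗ₜ[ℝ] v + p ⊗ₜ[ℝ] v
            + p ⊗ₜ[ℝ] wedgeL m (e m j) (dotL m (e m j) v) else 0) := by
      intro i j
      rw [hp_dw, Derivation.leibniz, pderiv_X, smul_eq_mul, smul_eq_mul]
      split_ifs with h
      · subst h
        simp only [Pi.single_eq_same, mul_one, TensorProduct.add_tmul, TensorProduct.tmul_sub,
          TensorProduct.tmul_neg]
        abel
      · simp [Pi.single_apply, h, Ne.symm h, TensorProduct.tmul_neg]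
    have e2 : ∑ j : Fin m, ((X j * pderiv j p) ⊗ₜ[ℝ] v + p ⊗ₜ[ℝ] v
            + p ⊗ₜ[ℝ] wedgeL m (e m j) (dotL m (e m j) v)) =
            ((m : ℝ) - s + k) • (p ⊗ₜ[ℝ] v) := by
      rw [Finset.sum_add_distrib, Finset.sum_add_distrib, ← TensorProduct.sum_tmul,
        ← TensorProduct.tmul_sum p Finset.univ (fun j => wedgeL m (e m j) (dotL m (e m j) v)), hp_sum_wd m s v hv, hp.sum_X_mul_pderiv]
      simp only [Finset.sum_const, Finset.card_univ, Fintype.card_fin, ← Nat.cast_smul_eq_nsmul ℝ,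
        TensorProduct.tmul_smul, ← TensorProduct.smul_tmul']
      module
    have e3 : ∑ j : Fin m, ∑ i : Fin m,
        (pderiv i (X j * p)) ⊗ₜ[ℝ] dotL m (e m i) (wedgeL m (e m j) v) =
        - (∑ j : Fin m, ∑ i : Fin m,
          (X j * pderiv i p) ⊗ₜ[ℝ] wedgeL m (e m j) (dotL m (e m i) v))
        - ((m : ℝ) - s + k) • (p ⊗ₜ[ℝ] v) := by
      simp only [e1, Finset.sum_sub_distrib, Finset.sum_neg_distrib]
      rw [← e2]
      simp
    rw [e3]
    conv_lhs => enter [1, 2]; rw [Finset.sum_comm]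
    abel
  rw [LinearMap.mem_ker] at this
  simp only [LinearMap.add_apply, LinearMap.comp_apply, LinearMap.smul_apply,
    LinearMap.id_apply] at this
  linear_combination (norm := module) this

end Helpers

/-- P_k^s = Ker_k^s∂⁻ ⊕ (x∧)Ker_{k-1}^{s-1}∂⁻, with projection
P⁻ = -(m-s+k)⁻¹ ∂⁻(x∧) onto the first summand (the second summand is intersected with
P_k^s, encoding the convention that polynomials of negative degree vanish). -/
theorem stmt13 (m k s : ℕ) (hs1 : 1 ≤ s) (hs2 : s ≤ m - 1) :
    Pks m k s = KerM m k s ⊔ (Submodule.map (xWedge m) (KerM m (k - 1) (s - 1)) ⊓ Pks m k s) ∧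
    KerM m k s ⊓ (Submodule.map (xWedge m) (KerM m (k - 1) (s - 1)) ⊓ Pks m k s) = ⊥ ∧
    ∀ P ∈ Pks m k s,
      (-(((m : ℝ) - (s : ℝ) + (k : ℝ))⁻¹) • (dminus m * xWedge m)) P ∈ KerM m k s ∧
      P - (-(((m : ℝ) - (s : ℝ) + (k : ℝ))⁻¹) • (dminus m * xWedge m)) P ∈
        Submodule.map (xWedge m) (KerM m (k - 1) (s - 1)) ⊓ Pks m k s := by
  obtain ⟨t, rfl⟩ : ∃ t, s = t + 1 := ⟨s - 1, by omega⟩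
  have hm : ((t + 1 : ℕ) : ℝ) + 1 ≤ m := by exact_mod_cast (by omega : t + 1 + 1 ≤ m)
  have hk : (0 : ℝ) ≤ k := Nat.cast_nonneg k
  have hc : (m : ℝ) - ((t + 1 : ℕ) : ℝ) + k ≠ 0 := by
    have : 0 < (m : ℝ) - ((t + 1 : ℕ) : ℝ) + k := by linarith
    exact this.ne'
  simp only [Nat.add_sub_cancel]
  have third : ∀ P ∈ Pks m k (t + 1),
      (-(((m : ℝ) - ((t + 1 : ℕ) : ℝ) + (k : ℝ))⁻¹) • (dminus m * xWedge m)) P ∈ KerM m k (t + 1) ∧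
      P - (-(((m : ℝ) - ((t + 1 : ℕ) : ℝ) + (k : ℝ))⁻¹) • (dminus m * xWedge m)) P ∈
        Submodule.map (xWedge m) (KerM m (k - 1) t) ⊓ Pks m k (t + 1) := by
    intro P hP
    have hkey := hp_key m k (t + 1) P hP
    have h1 : (-(((m : ℝ) - ((t + 1 : ℕ) : ℝ) + (k : ℝ))⁻¹) • (dminus m * xWedge m)) P
        ∈ KerM m k (t + 1) := by
      rw [LinearMap.smul_apply, Module.End.mul_apply]
      apply Submodule.smul_mem
      exact ⟨hp_dm_mem m (k + 1) (t + 1) _ (hp_xW_mem m k (t + 1) P hP), hp_dminus_sq m _⟩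
    refine ⟨h1, ?_, sub_mem hP h1.1⟩
    refine ⟨-(((m : ℝ) - ((t + 1 : ℕ) : ℝ) + (k : ℝ))⁻¹) • dminus m P,
      Submodule.smul_mem _ _ ⟨hp_dm_mem m k t P hP, hp_dminus_sq m P⟩, ?_⟩
    rw [LinearMap.smul_apply, Module.End.mul_apply, hkey, map_smul, smul_sub, neg_smul _ (_ • P),
      smul_smul, inv_mul_cancel₀ hc]
    module
  refine ⟨?_, ?_, third⟩
  · apply le_antisymm
    · intro P hP
      obtain ⟨h1, h2⟩ := third P hP
      have := add_mem (Submodule.mem_sup_left h1) (Submodule.mem_sup_right h2)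
      rwa [add_sub_cancel] at this
    · exact sup_le inf_le_left inf_le_right
  · rw [eq_bot_iff]
    rintro Q ⟨⟨-, hQ⟩, ⟨R, ⟨hR1, hR2⟩, rfl⟩, -⟩
    have hkey := hp_key m (k - 1) t R hR1
    have hQ' : dminus m (xWedge m R) = 0 := hQ
    have hR' : dminus m R = 0 := hR2
    rw [hQ', hR', map_zero, neg_zero, zero_sub, eq_comm, neg_eq_zero, smul_eq_zero] at hkey
    rcases hkey with h | h
    · exfalso
      have : (0 : ℝ) ≤ ((k - 1 : ℕ) : ℝ) := Nat.cast_nonneg _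
      push_cast at hm
      linarith
    · rw [h, map_zero]; exact zero_mem _
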